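/- arXiv:1706.09810 — 14 statements merged into one kernel-verified Lean document; each statement's English description precedes it below -/
import Mathlib

section
/- Let α > 0, k > 0, g ≥ 0 and a, h ∈ ℝ, and let M be the 2×2 real matrix M = [[−k, a−h+g], [(α+1)k, α(h−a)−(α+1)g]] (the Jacobian of the two-state glycolysis model at its equilibrium (1/k, 1)). Then every complex eigenvalue of M has strictly negative real part if and only if 0 < h − a and α(h − a) < k + g(1+α) (equivalently, 0 < h − a < (k + g(1+α))/α). -/
theorem hurwitz_quadratic (T D : ℝ) :
    (∀ μ : ℂ, μ ^ 2 - T * μ + D = 0 → μ.re < 0) ↔ (0 < D ∧ T < 0) := by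
  constructor
  · intro H
    constructor
    · by_contra hD
      push Not at hD
      have hnn : 0 ≤ T ^ 2 - 4 * D := by nlinarith [sq_nonneg T]
      have hs := Real.sq_sqrt hnn
      have hs0 := Real.sqrt_nonneg (T ^ 2 - 4 * D)
      set s := Real.sqrt (T ^ 2 - 4 * D)
      have h1 := H (((T + s) / 2 : ℝ) : ℂ) (by
        norm_cast
        nlinarith)
      rw [Complex.ofReal_re] at h1
      nlinarith
    · obtain ⟨s, hs⟩ := IsAlgClosed.exists_eq_mul_self ((T : ℂ) ^ 2 - 4 * D)
      have h1 := H ((T + s) / 2) (by linear_combination (-1 / 4 : ℂ) * hs)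
      have h2 := H ((T - s) / 2) (by linear_combination (-1 / 4 : ℂ) * hs)
      have h3 : ((T + s) / 2 + (T - s) / 2 : ℂ) = (T : ℂ) := by ring
      have h4 := congrArg Complex.re h3
      rw [Complex.add_re, Complex.ofReal_re] at h4
      linarith
  · rintro ⟨hD, hT⟩ μ hμ
    have hre := congrArg Complex.re hμ
    have him := congrArg Complex.im hμ
    simp [pow_two] at hre him
    have hy : μ.im * (2 * μ.re - T) = 0 := by linarith
    rcases mul_eq_zero.mp hy with h0 | h0
    · rw [h0] at hre
      by_contra hx
      push Not at hx
      nlinarith [mul_nonneg hx (neg_pos.mpr hT).le]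
    · linarith

/-- The Jacobian M = [[−k, a−h+g], [(α+1)k, α(h−a)−(α+1)g]] of the
two-state glycolysis model at its equilibrium (1/k, 1) is Hurwitz (all complex
eigenvalues have strictly negative real part) if and only if
0 < h − a and α(h − a) < k + g(1+α). -/
theorem two_state_glycolysis_stability (α k g a h : ℝ)
    (hα : 0 < α) (hk : 0 < k) (hg : 0 ≤ g) :
    (∀ μ ∈ spectrum ℂ
        ((Matrix.of ![![-k, a - h + g], ![(α + 1) * k, α * (h - a) - (α + 1) * g]]).map
          (algebraMap ℝ ℂ)),
      μ.re < 0) ↔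
    (0 < h - a ∧ α * (h - a) < k + g * (1 + α)) := by
  have key := hurwitz_quadratic (-k + α * (h - a) - (α + 1) * g) (k * (h - a))
  have hR : (0 < h - a ∧ α * (h - a) < k + g * (1 + α)) ↔
      (0 < k * (h - a) ∧ -k + α * (h - a) - (α + 1) * g < 0) := by
    rw [mul_pos_iff_of_pos_left hk]
    constructor
    · rintro ⟨h1, h2⟩
      exact ⟨h1, by linarith⟩
    · rintro ⟨h1, h2⟩
      exact ⟨h1, by linarith⟩
  rw [hR, ← key]
  refine forall_congr' fun μ => ?_
  have hs : μ ∈ spectrum ℂ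
        ((Matrix.of ![![-k, a - h + g], ![(α + 1) * k, α * (h - a) - (α + 1) * g]]).map
          (algebraMap ℝ ℂ)) ↔
      μ ^ 2 - ((-k + α * (h - a) - (α + 1) * g : ℝ) : ℂ) * μ + ((k * (h - a) : ℝ) : ℂ) = 0 := by
    rw [spectrum.mem_iff, Matrix.isUnit_iff_isUnit_det, isUnit_iff_ne_zero, not_not,
      Matrix.det_fin_two]
    simp [Matrix.algebraMap_matrix_apply]
    apply Eq.congr_left
    ring
  rw [hs]
end

section
/- (Scalar minimum-energy hard limit.) Let λ > 0 and b ≠ 0. Suppose z : [0,∞) → ℝ is differentiable with z′(t) = λ z(t) + b u(t) for all t ≥ 0, u is measurable with ∫₀^∞ u(t)² dt < ∞, and z(t) → 0 as t → ∞. Then ∫₀^∞ u(t)² dt ≥ 2λ z(0)² / b². -/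
open MeasureTheory Filter

/-- Scalar minimum-energy hard limit: For λ > 0, b ≠ 0, if
z′(t) = λz(t) + b·u(t) on [0,∞), u is measurable with ∫₀^∞ u² < ∞ and
z(t) → 0 as t → ∞, then ∫₀^∞ u(t)² dt ≥ 2λ z(0)² / b². -/
theorem scalar_minimum_energy_hard_limit (l b : ℝ) (hl : 0 < l) (hb : b ≠ 0)
    (z u : ℝ → ℝ)
    (hz : ∀ t : ℝ, 0 ≤ t → HasDerivAt z (l * z t + b * u t) t)
    (hu : Measurable u)
    (hui : IntegrableOn (fun t => u t ^ 2) (Set.Ioi 0))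
    (hlim : Tendsto z atTop (nhds 0)) :
    ∫ t in Set.Ioi (0 : ℝ), u t ^ 2 ≥ 2 * l * z 0 ^ 2 / b ^ 2 := by
  have key : ∀ T : ℝ, 0 ≤ T →
      2 * l * z 0 ^ 2 - 2 * l * z T ^ 2 ≤ b ^ 2 * ∫ t in Set.Ioi (0 : ℝ), u t ^ 2 := by
    intro T hT
    have hd : ∀ t : ℝ, 0 ≤ t → HasDerivAt (fun t => -(2 * l) * z t ^ 2)
        (-(2 * l) * (2 * z t * (l * z t + b * u t))) t := by
      intro t ht
      have h := ((hz t ht).pow 2).const_mul (-(2 * l))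
      refine h.congr_deriv ?_
      norm_num
    have hI : IntegrableOn (fun t => b ^ 2 * u t ^ 2) (Set.Icc 0 T) := by
      rw [integrableOn_Icc_iff_integrableOn_Ioc]
      exact (hui.mono_set Set.Ioc_subset_Ioi_self).const_mul _
    have h1 := intervalIntegral.sub_le_integral_of_hasDeriv_right_of_le hT
      (fun t ht => (hd t ht.1).continuousAt.continuousWithinAt)
      (fun t ht => (hd t ht.1.le).hasDerivWithinAt) hI
      (fun t _ => by nlinarith [sq_nonneg (b * u t + 2 * l * z t)])
    rw [intervalIntegral.integral_const_mul, intervalIntegral.integral_of_le hT] at h1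
    have h2 : ∫ t in Set.Ioc 0 T, u t ^ 2 ≤ ∫ t in Set.Ioi (0 : ℝ), u t ^ 2 :=
      setIntegral_mono_set hui (Eventually.of_forall fun t => sq_nonneg (u t))
        (Set.Ioc_subset_Ioi_self).eventuallyLE
    have h3 := mul_le_mul_of_nonneg_left h2 (sq_nonneg b)
    linarith
  have hlim2 : Tendsto (fun T => 2 * l * z 0 ^ 2 - 2 * l * z T ^ 2) atTop
      (nhds (2 * l * z 0 ^ 2 - 2 * l * 0 ^ 2)) :=
    ((hlim.pow 2).const_mul _).const_sub _
  have h := le_of_tendsto hlim2 ((eventually_ge_atTop 0).mono key)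
  rw [ge_iff_le, div_le_iff₀ (by positivity)]
  linarith
end

section
/- (Scalar disturbance-attenuation hard limit.) Let λ > 0, b ≠ 0 and c ∈ ℝ, and let δ(t) = e^{−λt}. Suppose z : [0,∞) → ℝ is differentiable with z′(t) = λ z(t) + b u(t) + c δ(t) for all t ≥ 0, z(0) = 0, z(t) → 0 as t → ∞, and u is measurable with ∫₀^∞ u(t)² dt < ∞. Then ∫₀^∞ u(t)² dt ≥ (c/b)² ∫₀^∞ δ(t)² dt, i.e., ∫₀^∞ u(t)² dt ≥ c²/(2λ b²). -/
open MeasureTheory Filter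

/-- Scalar disturbance-attenuation hard limit: For λ > 0, b ≠ 0,
c ∈ ℝ and the disturbance δ(t) = e^{−λt}, if z′(t) = λz(t) + b·u(t) + c·δ(t) on
[0,∞), z(0) = 0, z(t) → 0 as t → ∞, and u is measurable with ∫₀^∞ u² < ∞, then
∫₀^∞ u² ≥ (c/b)² ∫₀^∞ δ², i.e. ∫₀^∞ u² ≥ c²/(2λb²). -/
theorem scalar_disturbance_attenuation_hard_limit (l b c : ℝ) (hl : 0 < l) (hb : b ≠ 0)
    (z u : ℝ → ℝ)
    (hz : ∀ t : ℝ, 0 ≤ t →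
      HasDerivAt z (l * z t + b * u t + c * Real.exp (-l * t)) t)
    (hz0 : z 0 = 0)
    (hu : Measurable u)
    (hui : IntegrableOn (fun t => u t ^ 2) (Set.Ioi 0))
    (hlim : Tendsto z atTop (nhds 0)) :
    (∫ t in Set.Ioi (0 : ℝ), u t ^ 2) ≥
      (c / b) ^ 2 * ∫ t in Set.Ioi (0 : ℝ), (Real.exp (-l * t)) ^ 2 ∧
    (∫ t in Set.Ioi (0 : ℝ), u t ^ 2) ≥ c ^ 2 / (2 * l * b ^ 2) := by
  have hsq : ∀ t : ℝ, Real.exp (-l * t) ^ 2 = Real.exp ((-(2 * l)) * t) := by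
    intro t
    rw [← Real.exp_nat_mul]
    congr 1
    push_cast
    ring
  have hei : IntegrableOn (fun t => Real.exp (-l * t) ^ 2) (Set.Ioi 0) := by
    simp_rw [hsq]
    exact integrableOn_exp_mul_Ioi (by linarith) 0
  have hE : ∫ t in Set.Ioi (0 : ℝ), (Real.exp (-l * t)) ^ 2 = 1 / (2 * l) := by
    simp_rw [hsq]
    rw [integral_exp_mul_Ioi (by linarith) 0]
    simp
  have hem : Measurable (fun t : ℝ => Real.exp (-l * t)) := by fun_prop
  have hpi : IntegrableOn (fun t => Real.exp (-l * t) * u t) (Set.Ioi 0) := by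
    refine Integrable.mono' (hei.add hui) (hem.mul hu).aestronglyMeasurable ?_
    filter_upwards with t
    simp only [Pi.add_apply, Real.norm_eq_abs]
    rw [abs_le]
    constructor <;>
      nlinarith [sq_nonneg (Real.exp (-l * t) + u t), sq_nonneg (Real.exp (-l * t) - u t),
        sq_nonneg (u t), sq_nonneg (Real.exp (-l * t))]
  have hd : ∀ t ∈ Set.Ici (0 : ℝ), HasDerivAt (fun t => Real.exp (-l * t) * z t)
      (b * (Real.exp (-l * t) * u t) + c * Real.exp (-l * t) ^ 2) t := by
    intro t ht
    have h1 : HasDerivAt (fun t : ℝ => Real.exp (-l * t)) (Real.exp (-l * t) * (-l * 1)) t :=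
      ((hasDerivAt_id t).const_mul (-l)).exp
    have h2 : HasDerivAt (fun t => Real.exp (-l * t) * z t) _ t := h1.mul (hz t ht)
    refine h2.congr_deriv ?_
    ring
  have hexp : Tendsto (fun t : ℝ => Real.exp (-l * t)) atTop (nhds 0) :=
    Real.tendsto_exp_atBot.comp (tendsto_id.const_mul_atTop_of_neg (by linarith))
  have hw : Tendsto (fun t => Real.exp (-l * t) * z t) atTop (nhds 0) := by
    simpa using hexp.mul hlim
  have hI := integral_Ioi_of_hasDerivAt_of_tendsto' hd
    ((hpi.const_mul b).add (hei.const_mul c)) hw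
  rw [integral_add (hpi.const_mul b) (hei.const_mul c), integral_const_mul,
    integral_const_mul, hE, hz0] at hI
  have hpos : 0 ≤ ∫ t in Set.Ioi (0 : ℝ), (u t + (c / b) * Real.exp (-l * t)) ^ 2 :=
    integral_nonneg fun t => sq_nonneg _
  have hexpand : ∫ t in Set.Ioi (0 : ℝ), (u t + (c / b) * Real.exp (-l * t)) ^ 2 =
      (∫ t in Set.Ioi (0 : ℝ), u t ^ 2) +
        (2 * (c / b) * (∫ t in Set.Ioi (0 : ℝ), Real.exp (-l * t) * u t) +
        (c / b) ^ 2 * (1 / (2 * l))) := by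
    have h3 : IntegrableOn (fun t => 2 * (c / b) * (Real.exp (-l * t) * u t) +
        (c / b) ^ 2 * Real.exp (-l * t) ^ 2) (Set.Ioi 0) :=
      (hpi.const_mul _).add (hei.const_mul _)
    rw [← hE, ← integral_const_mul, ← integral_const_mul,
      ← integral_add (hpi.const_mul _) (hei.const_mul _),
      ← integral_add hui h3]
    congr 1
    ext t
    ring
  rw [hexpand] at hpos
  have hP : ∫ t in Set.Ioi (0 : ℝ), Real.exp (-l * t) * u t = -(c / b) * (1 / (2 * l)) := by
    have hl' := hl.ne'
    apply mul_left_cancel₀ hb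
    have : b * (-(c / b) * (1 / (2 * l))) = -(c * (1 / (2 * l))) := by field_simp
    rw [this]
    linarith
  rw [hP] at hpos
  have key : (∫ t in Set.Ioi (0 : ℝ), u t ^ 2) ≥ (c / b) ^ 2 * (1 / (2 * l)) := by
    linarith
  rw [hE]
  refine ⟨key, ?_⟩
  have : c ^ 2 / (2 * l * b ^ 2) = (c / b) ^ 2 * (1 / (2 * l)) := by
    field_simp
  rw [this]
  exact key
end

section
/- (Hard limit of Theorem 1, two-state glycolysis.) Let α > 0, k > 0, g ≥ 0, and let δ(t) = e^{−(k/α)t}. Suppose z : [0,∞) → ℝ is differentiable and satisfies the linearized zero-dynamics of the two-state glycolysis model, z′(t) = (k/α) z(t) − ((gα+k)/α²) y(t) − (1/α) δ(t), with z(0) = 0, z(t) → 0 as t → ∞, and y measurable with ∫₀^∞ y(t)² dt < ∞. Then ∫₀^∞ y(t)² dt ≥ (α/(k+gα))² ∫₀^∞ δ(t)² dt. Hence the best achievable L²-gain disturbance attenuation γ* from δ to y satisfies γ* ≥ α/(k+gα). -/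
open MeasureTheory Filter

/-- Hard limit of Theorem 1, two-state glycolysis: For α > 0,
k > 0, g ≥ 0 and the disturbance δ(t) = e^{−(k/α)t}, any solution of the
linearized zero-dynamics z′ = (k/α)z − ((gα+k)/α²)y − (1/α)δ with z(0) = 0,
z(t) → 0, and square-integrable output y satisfies
∫₀^∞ y² ≥ (α/(k+gα))² ∫₀^∞ δ²; hence γ* ≥ α/(k+gα). -/
theorem two_state_glycolysis_L2_gain_hard_limit (α k g : ℝ)
    (hα : 0 < α) (hk : 0 < k) (hg : 0 ≤ g)
    (z y : ℝ → ℝ)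
    (hz : ∀ t : ℝ, 0 ≤ t →
      HasDerivAt z
        ((k / α) * z t - ((g * α + k) / α ^ 2) * y t
          - (1 / α) * Real.exp (-(k / α) * t)) t)
    (hz0 : z 0 = 0)
    (hy : Measurable y)
    (hyi : IntegrableOn (fun t => y t ^ 2) (Set.Ioi 0))
    (hlim : Tendsto z atTop (nhds 0)) :
    (∫ t in Set.Ioi (0 : ℝ), y t ^ 2) ≥
      (α / (k + g * α)) ^ 2 * ∫ t in Set.Ioi (0 : ℝ), (Real.exp (-(k / α) * t)) ^ 2 := by
  have hS : 0 < k + g * α := by positivity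
  set G := α / (k + g * α) with hG
  set a := k / α with ha
  have ha0 : 0 < a := by positivity
  have hei : IntegrableOn (fun t : ℝ => (Real.exp (-a * t)) ^ 2) (Set.Ioi 0) := by
    have h := integrableOn_exp_mul_Ioi (a := -(2 * a)) (by linarith) 0
    refine h.congr_fun (fun t _ => ?_) measurableSet_Ioi
    show Real.exp (-(2 * a) * t) = Real.exp (-a * t) ^ 2
    rw [← Real.exp_nat_mul]
    congr 1
    push_cast
    ring
  have hyei : IntegrableOn (fun t : ℝ => y t * Real.exp (-a * t)) (Set.Ioi 0) := by
    refine Integrable.mono' (hyi.add hei) ?_ ?_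
    · exact (hy.mul (by fun_prop)).aestronglyMeasurable
    · refine Filter.Eventually.of_forall (fun t => ?_)
      simp only [Pi.add_apply, Real.norm_eq_abs]
      rw [abs_le]
      constructor <;>
        nlinarith [sq_nonneg (y t + Real.exp (-a * t)), sq_nonneg (y t - Real.exp (-a * t)),
          sq_nonneg (y t), sq_nonneg (Real.exp (-a * t))]
  have hsum : IntegrableOn
      (fun t : ℝ => -((g * α + k) / α ^ 2) * (y t * Real.exp (-a * t))
        + -(1 / α) * (Real.exp (-a * t)) ^ 2) (Set.Ioi 0) :=
    (hyei.const_mul _).add (hei.const_mul _)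
  have hd : ∀ t ∈ Set.Ici (0 : ℝ), HasDerivAt (fun t => z t * Real.exp (-a * t))
      (-((g * α + k) / α ^ 2) * (y t * Real.exp (-a * t))
        + -(1 / α) * (Real.exp (-a * t)) ^ 2) t := by
    intro t ht
    have h2 : HasDerivAt (fun t : ℝ => Real.exp (-a * t)) (Real.exp (-a * t) * (-a * 1)) t :=
      ((hasDerivAt_id t).const_mul (-a)).exp
    refine ((hz t ht).mul h2).congr_deriv ?_
    ring
  have hexp : Tendsto (fun t : ℝ => Real.exp (-a * t)) atTop (nhds 0) :=
    Real.tendsto_exp_atBot.comp (tendsto_id.const_mul_atTop_of_neg (by linarith))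
  have hl : Tendsto (fun t => z t * Real.exp (-a * t)) atTop (nhds 0) := by
    simpa using hlim.mul hexp
  have hI := integral_Ioi_of_hasDerivAt_of_tendsto' hd hsum hl
  rw [hz0, zero_mul, sub_zero, integral_add (hyei.const_mul _) (hei.const_mul _),
    integral_const_mul, integral_const_mul] at hI
  have hM : ∫ t in Set.Ioi (0 : ℝ), ((-2 * G) * (y t * Real.exp (-a * t))
      + (-G ^ 2) * (Real.exp (-a * t)) ^ 2) ≤ ∫ t in Set.Ioi (0 : ℝ), y t ^ 2 := by
    refine integral_mono ((hyei.const_mul _).add (hei.const_mul _)) hyi (fun t => ?_)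
    show (-2 * G) * (y t * Real.exp (-a * t)) + (-G ^ 2) * (Real.exp (-a * t)) ^ 2 ≤ y t ^ 2
    nlinarith [sq_nonneg (y t + G * Real.exp (-a * t))]
  rw [integral_add (hyei.const_mul _) (hei.const_mul _),
    integral_const_mul, integral_const_mul] at hM
  set A := ∫ t in Set.Ioi (0 : ℝ), y t * Real.exp (-a * t)
  set B := ∫ t in Set.Ioi (0 : ℝ), (Real.exp (-a * t)) ^ 2
  have hA : A = -G * B := by
    rw [hG]
    field_simp at hI ⊢
    linarith
  rw [hA] at hM
  linarith
end

section
/- (Hard limit of Theorem 3, minimum ATP output energy.) Let α > 0, k > 0, g ≥ 0 and z₀ ∈ ℝ. Suppose z : [0,∞) → ℝ is differentiable with z′(t) = (k/α) z(t) − ((gα+k)/α²) y(t) for all t ≥ 0, z(0) = z₀, z(t) → 0 as t → ∞, and y is measurable with ∫₀^∞ y(t)² dt < ∞. Then ∫₀^∞ y(t)² dt ≥ 2α³k z₀²/(gα+k)²; in particular ∫₀^∞ y(t)² dt ≥ α³k z₀²/(gα+k)². -/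
open MeasureTheory Filter

/-- Hard limit of Theorem 3, minimum ATP output energy: For α > 0,
k > 0, g ≥ 0 and z₀ ∈ ℝ, any solution of z′ = (k/α)z − ((gα+k)/α²)y with
z(0) = z₀, z(t) → 0, and square-integrable y satisfies
∫₀^∞ y² ≥ 2α³k z₀²/(gα+k)²; in particular ∫₀^∞ y² ≥ α³k z₀²/(gα+k)². -/
theorem two_state_glycolysis_min_output_energy (α k g z₀ : ℝ)
    (hα : 0 < α) (hk : 0 < k) (hg : 0 ≤ g)
    (z y : ℝ → ℝ)
    (hz : ∀ t : ℝ, 0 ≤ t →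
      HasDerivAt z ((k / α) * z t - ((g * α + k) / α ^ 2) * y t) t)
    (hz0 : z 0 = z₀)
    (hy : Measurable y)
    (hyi : IntegrableOn (fun t => y t ^ 2) (Set.Ioi 0))
    (hlim : Tendsto z atTop (nhds 0)) :
    (∫ t in Set.Ioi (0 : ℝ), y t ^ 2) ≥ 2 * α ^ 3 * k * z₀ ^ 2 / (g * α + k) ^ 2 ∧
    (∫ t in Set.Ioi (0 : ℝ), y t ^ 2) ≥ α ^ 3 * k * z₀ ^ 2 / (g * α + k) ^ 2 := by
  have hb : 0 < g * α + k := by positivity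
  have key : z₀ ^ 2 ≤ ((g * α + k) ^ 2 / (2 * α ^ 3 * k)) * ∫ t in Set.Ioi (0 : ℝ), y t ^ 2 := by
    set c : ℝ := (g * α + k) ^ 2 / (2 * α ^ 3 * k) with hc
    have hc0 : 0 ≤ c := by positivity
    have hT : ∀ T : ℝ, 0 ≤ T → z₀ ^ 2 - z T ^ 2 ≤ c * ∫ t in Set.Ioi (0 : ℝ), y t ^ 2 := by
      intro T hT
      have h1 : (∫ t in (0 : ℝ)..T, -c * y t ^ 2) ≤ z T ^ 2 - z 0 ^ 2 := by
        refine intervalIntegral.integral_le_sub_of_hasDeriv_right_of_le (g := fun t => z t ^ 2)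
          (g' := fun t => 2 * z t * ((k / α) * z t - ((g * α + k) / α ^ 2) * y t)) hT ?_ ?_ ?_ ?_
        · intro t ht
          exact ((hz t ht.1).continuousAt.pow 2).continuousWithinAt
        · intro t ht
          have := ((hz t ht.1.le).fun_pow 2).hasDerivWithinAt (s := Set.Ioi t)
          simpa using this
        · have h2 : IntegrableOn (fun t => y t ^ 2) (Set.Icc 0 T) := by
            rw [integrableOn_Icc_iff_integrableOn_Ioc]
            exact hyi.mono_set Set.Ioc_subset_Ioi_self
          exact h2.const_mul (-c)
        · intro t _
          have : 2 * z t * ((k / α) * z t - ((g * α + k) / α ^ 2) * y t) - (-c * y t ^ 2)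
              = (2 * α * k * z t - (g * α + k) * y t) ^ 2 / (2 * α ^ 3 * k) := by
            rw [hc]; field_simp; ring
          have h3 : 0 ≤ (2 * α * k * z t - (g * α + k) * y t) ^ 2 / (2 * α ^ 3 * k) := by
            positivity
          linarith
      rw [intervalIntegral.integral_const_mul, intervalIntegral.integral_of_le hT, hz0] at h1
      have h4 : (∫ t in Set.Ioc (0 : ℝ) T, y t ^ 2) ≤ ∫ t in Set.Ioi (0 : ℝ), y t ^ 2 :=
        setIntegral_mono_set hyi (Eventually.of_forall fun t => sq_nonneg (y t))
          Set.Ioc_subset_Ioi_self.eventuallyLE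
      have := mul_le_mul_of_nonneg_left h4 hc0
      linarith
    have hl : Tendsto (fun T => z₀ ^ 2 - z T ^ 2) atTop (nhds (z₀ ^ 2)) := by
      simpa using (hlim.pow 2).const_sub (z₀ ^ 2)
    exact le_of_tendsto hl ((eventually_ge_atTop 0).mono hT)
  have h1 : (∫ t in Set.Ioi (0 : ℝ), y t ^ 2) ≥ 2 * α ^ 3 * k * z₀ ^ 2 / (g * α + k) ^ 2 := by
    rw [ge_iff_le, div_le_iff₀ (by positivity)]
    rw [div_mul_eq_mul_div, le_div_iff₀ (by positivity)] at key
    linarith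
  refine ⟨h1, le_trans ?_ h1⟩
  gcongr
  nlinarith [show 0 < α ^ 3 * k by positivity]
end

section
/- Let n ≥ 1, K > 0, α > 0, and let A be the n×n real matrix A = −K·I + K·S + ((α+1)/α)K·E, where S is the subdiagonal shift matrix (Sᵢⱼ = 1 if i = j+1, else 0) and E is the matrix with a single 1 in position (row 0, column n−1). Then the characteristic polynomial of A is (X + K)ⁿ − ((α+1)/α)·Kⁿ. -/
/-- The subdiagonal shift matrix: Sᵢⱼ = 1 if i = j+1, else 0. -/
def subShift (n : ℕ) : Matrix (Fin n) (Fin n) ℝ :=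
  Matrix.of fun i j => if (i : ℕ) = (j : ℕ) + 1 then 1 else 0

/-- The single-entry matrix with a 1 in position (row 0, column n−1). -/
def cornerE (n : ℕ) : Matrix (Fin n) (Fin n) ℝ :=
  Matrix.of fun i j => if (i : ℕ) = 0 ∧ (j : ℕ) = n - 1 then 1 else 0

/-- The linearized zero-dynamics matrix A = −K·I + K·S + ((α+1)/α)K·E of the
glycolysis pathway with n intermediate reactions. -/
noncomputable def glyA (n : ℕ) (K α : ℝ) : Matrix (Fin n) (Fin n) ℝ :=
  (-K) • (1 : Matrix (Fin n) (Fin n) ℝ) + K • subShift n + (((α + 1) / α) * K) • cornerE n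

theorem det_cyc {R : Type*} [CommRing R] (m : ℕ) (a b d : R)
    (M : Matrix (Fin (m + 1)) (Fin (m + 1)) R)
    (hM : ∀ i j, M i j = (if (i : ℕ) = j then a else 0) + (if (i : ℕ) = (j : ℕ) + 1 then b else 0)
      + (if (i : ℕ) = 0 ∧ (j : ℕ) = m then d else 0)) :
    M.det = a ^ (m + 1) + (-1) ^ m * d * b ^ m := by
  have h0 : ∀ j, M 0 j = (if j = 0 then a else 0) + (if j = Fin.last m then d else 0) := by
    intro j
    rw [hM]
    simp only [Fin.ext_iff, Fin.val_zero, Fin.val_last, eq_comm (a := 0) (b := (j : ℕ))]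
    simp
  have h1 : (M.submatrix Fin.succ (Fin.succAbove 0)).det = a ^ m := by
    rw [Matrix.det_of_isLowerTriangular]
    · simp [hM]
    · intro i j hij
      have hij' : (i : ℕ) < j := hij
      simp only [Matrix.submatrix_apply, hM, Fin.succAbove_zero, Fin.val_succ]
      rw [if_neg (by omega), if_neg (by omega), if_neg (by omega)]
      simp
  have h2 : (M.submatrix Fin.succ (Fin.succAbove (Fin.last m))).det = b ^ m := by
    rw [Matrix.det_of_isUpperTriangular]
    · simp [hM]
    · intro i j hij
      have hij' : (j : ℕ) < i := hij
      simp only [Matrix.submatrix_apply, hM, Fin.succAbove_last, Fin.val_succ, Fin.val_castSucc]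
      rw [if_neg (by omega), if_neg (by omega), if_neg (by omega)]
      simp
  rw [Matrix.det_succ_row_zero]
  simp only [h0, mul_add, add_mul, Finset.sum_add_distrib, mul_ite, ite_mul, mul_zero, zero_mul,
    Finset.sum_ite_eq', Finset.sum_ite_eq, Finset.mem_univ, if_true]
  rw [h1, h2]
  simp [pow_succ']

/-- The characteristic polynomial of
A = −K·I + K·S + ((α+1)/α)K·E is (X + K)ⁿ − ((α+1)/α)Kⁿ. -/
theorem glyA_charpoly (n : ℕ) (hn : 1 ≤ n) (K α : ℝ) (hK : 0 < K) (hα : 0 < α) :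
    (glyA n K α).charpoly =
      (Polynomial.X + Polynomial.C K) ^ n - Polynomial.C (((α + 1) / α) * K ^ n) := by
  obtain ⟨m, rfl⟩ : ∃ m, n = m + 1 := ⟨n - 1, by omega⟩
  rw [Matrix.charpoly, det_cyc m (Polynomial.X + Polynomial.C K) (-Polynomial.C K)
    (-Polynomial.C (((α + 1) / α) * K))]
  · rw [neg_pow (Polynomial.C K)]
    have h : ((-1 : Polynomial ℝ) ^ m) * (-1) ^ m = 1 := by
      rw [← mul_pow]; simp
    simp only [map_mul, map_pow]
    linear_combination (-Polynomial.C ((α + 1) / α) * Polynomial.C K ^ (m + 1)) * h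
  · intro i j
    rw [Matrix.charmatrix_apply, Matrix.diagonal_apply]
    simp only [glyA, subShift, cornerE, Matrix.add_apply, Matrix.smul_apply, Matrix.of_apply,
      Matrix.one_apply, Fin.ext_iff, smul_eq_mul, Nat.add_sub_cancel]
    split_ifs <;> simp <;> ring
end

section
/- Let n ≥ 1, K > 0, α > 0, and let A be the n×n real matrix A = −K·I + K·S + ((α+1)/α)K·E, where S is the subdiagonal shift matrix and E has a single 1 in position (0, n−1). Set q = ((α+1)/α)^{1/n} and λ = K(q − 1). Then λ is an eigenvalue of A, and every complex eigenvalue μ of A satisfies Re μ ≤ λ; i.e., λ is the eigenvalue of A with greatest real part. -/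
lemma glyA_mulVec_zero (m : ℕ) (K α : ℝ) (v : Fin (m+1) → ℂ) :
    (((glyA (m+1) K α).map (algebraMap ℝ ℂ)).mulVec v) 0
      = -K * v 0 + (((α + 1) / α : ℝ) : ℂ) * K * v (Fin.last m) := by
  have h : ∀ j : Fin (m+1), ((glyA (m+1) K α).map (algebraMap ℝ ℂ)) 0 j * v j
      = (if 0 = j then -K * v j else 0)
        + (if j = Fin.last m then (((α + 1) / α : ℝ) : ℂ) * K * v j else 0) := by
    intro j
    have e : (j : ℕ) = m ↔ j = Fin.last m := by simp [Fin.ext_iff]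
    simp only [glyA, subShift, cornerE, Matrix.map_apply, Matrix.add_apply, Matrix.smul_apply,
      Matrix.of_apply, Matrix.one_apply, Fin.val_zero, true_and, Nat.add_sub_cancel, e,
      smul_eq_mul]
    have h0 : ¬ (0 = (j : ℕ) + 1) := by omega
    simp only [h0, if_false]
    split_ifs <;> simp <;> ring
  simp only [Matrix.mulVec, dotProduct, h, Finset.sum_add_distrib]
  simp

lemma glyA_mulVec_succ (m : ℕ) (K α : ℝ) (v : Fin (m+1) → ℂ) (i : Fin m) :
    (((glyA (m+1) K α).map (algebraMap ℝ ℂ)).mulVec v) i.succ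
      = -K * v i.succ + K * v i.castSucc := by
  have h : ∀ j : Fin (m+1), ((glyA (m+1) K α).map (algebraMap ℝ ℂ)) i.succ j * v j
      = (if i.succ = j then -K * v j else 0)
        + (if i.castSucc = j then K * v j else 0) := by
    intro j
    have e : (i : ℕ) = (j : ℕ) ↔ i.castSucc = j := by simp [Fin.ext_iff]
    simp only [glyA, subShift, cornerE, Matrix.map_apply, Matrix.add_apply, Matrix.smul_apply,
      Matrix.of_apply, Matrix.one_apply, Fin.val_succ, Nat.add_right_cancel_iff, e,
      smul_eq_mul]
    have h0 : ¬ ((i : ℕ) + 1 = 0 ∧ (j : ℕ) = m + 1 - 1) := by omega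
    rw [if_neg h0]
    split_ifs <;> simp
  simp only [Matrix.mulVec, dotProduct, h, Finset.sum_add_distrib]
  simp

lemma mem_spectrum_iff_vec {n : ℕ} (A : Matrix (Fin n) (Fin n) ℂ) (μ : ℂ) :
    μ ∈ spectrum ℂ A ↔ ∃ v, v ≠ 0 ∧ A.mulVec v = μ • v := by
  rw [← Matrix.spectrum_toLin', ← Module.End.hasEigenvalue_iff_mem_spectrum]
  constructor
  · intro h
    obtain ⟨v, hv⟩ := h.exists_hasEigenvector
    exact ⟨v, hv.2, by simpa using hv.apply_eq_smul⟩
  · rintro ⟨v, hv, h⟩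
    exact Module.End.hasEigenvalue_of_hasEigenvector
      (x := v) ⟨Module.End.mem_eigenspace_iff.2 (by simpa using h), hv⟩

lemma glyA_mem_spectrum (m : ℕ) (K α : ℝ) (hK : 0 < K) (z : ℂ) :
    K * (z - 1) ∈ spectrum ℂ ((glyA (m+1) K α).map (algebraMap ℝ ℂ)) ↔
      z ^ (m+1) = (((α + 1) / α : ℝ) : ℂ) := by
  have hK' : (K : ℂ) ≠ 0 := by exact_mod_cast hK.ne'
  rw [mem_spectrum_iff_vec]
  constructor
  · rintro ⟨v, hv, h⟩
    have h0 := congrFun h 0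
    rw [glyA_mulVec_zero] at h0
    have hs : ∀ i : Fin m, v i.castSucc = z * v i.succ := by
      intro i
      have h1 := congrFun h i.succ
      rw [glyA_mulVec_succ] at h1
      simp only [Pi.smul_apply, smul_eq_mul] at h1
      apply mul_left_cancel₀ hK'
      linear_combination h1
    have hz : z * v 0 = (((α + 1) / α : ℝ) : ℂ) * v (Fin.last m) := by
      simp only [Pi.smul_apply, smul_eq_mul] at h0
      apply mul_left_cancel₀ hK'
      linear_combination -h0
    have hall : ∀ i : Fin (m+1), v i = z ^ (m - (i : ℕ)) * v (Fin.last m) := by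
      intro i
      induction i using Fin.reverseInduction with
      | last => simp
      | cast i ih =>
        rw [hs, ih]
        have : m - (i.castSucc : ℕ) = (m - (i.succ : ℕ)) + 1 := by
          simp; omega
        rw [this, pow_succ]; ring
    have hl : v (Fin.last m) ≠ 0 := by
      intro h2
      apply hv
      funext i
      rw [hall, h2]; simp
    rw [hall 0] at hz
    apply mul_right_cancel₀ hl
    rw [← hz]
    simp [pow_succ]; ring
  · intro hz
    refine ⟨fun i => z ^ (m - (i : ℕ)), ?_, ?_⟩
    · intro h
      simpa using congrFun h (Fin.last m)
    · funext i
      refine Fin.cases ?_ (fun i => ?_) i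
      · rw [glyA_mulVec_zero, ← hz]
        simp [pow_succ]; ring
      · rw [glyA_mulVec_succ]
        have : m - (i.castSucc : ℕ) = (m - (i.succ : ℕ)) + 1 := by
          simp; omega
        simp only [this, pow_succ, Pi.smul_apply, smul_eq_mul]; ring

/-- With q = ((α+1)/α)^{1/n} and λ = K(q − 1), λ is an eigenvalue
of A = −K·I + K·S + ((α+1)/α)K·E, and every complex eigenvalue μ of A
satisfies Re μ ≤ λ. -/
theorem glyA_dominant_eigenvalue (n : ℕ) (hn : 1 ≤ n) (K α : ℝ) (hK : 0 < K) (hα : 0 < α) :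
    ((K * (((α + 1) / α) ^ ((1 : ℝ) / n) - 1) : ℝ) : ℂ) ∈
        spectrum ℂ ((glyA n K α).map (algebraMap ℝ ℂ)) ∧
      ∀ μ ∈ spectrum ℂ ((glyA n K α).map (algebraMap ℝ ℂ)),
        μ.re ≤ K * (((α + 1) / α) ^ ((1 : ℝ) / n) - 1) := by
  obtain ⟨m, rfl⟩ : ∃ m, n = m + 1 := ⟨n - 1, by omega⟩
  have hc : 0 ≤ (α + 1) / α := by positivity
  have hK' : (K : ℂ) ≠ 0 := by exact_mod_cast hK.ne'
  have hq0 : 0 ≤ ((α + 1) / α) ^ ((1 : ℝ) / (m + 1 : ℕ)) := Real.rpow_nonneg hc _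
  have hq : (((α + 1) / α) ^ ((1 : ℝ) / (m + 1 : ℕ))) ^ (m + 1) = (α + 1) / α := by
    rw [one_div]
    exact Real.rpow_inv_natCast_pow hc (by omega)
  generalize ((α + 1) / α) ^ ((1 : ℝ) / (m + 1 : ℕ)) = q at hq0 hq
  constructor
  · have := (glyA_mem_spectrum m K α hK (q : ℂ)).2 (by rw [← hq]; push_cast; rfl)
    simpa using this
  · intro μ hμ
    obtain ⟨z, rfl⟩ : ∃ z : ℂ, μ = K * (z - 1) := ⟨μ / K + 1, by field_simp; ring⟩
    have hz := (glyA_mem_spectrum m K α hK z).1 hμ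
    have hn : ‖z‖ ^ (m+1) = q ^ (m+1) := by
      rw [← norm_pow, hz, hq, Complex.norm_real, Real.norm_of_nonneg hc]
    have hzq : ‖z‖ = q := (pow_left_inj₀ (norm_nonneg _) hq0 (by omega)).1 hn
    have hre : z.re ≤ q := hzq ▸ Complex.re_le_norm z
    have : ((K : ℂ) * (z - 1)).re = K * (z.re - 1) := by simp
    rw [this]
    gcongr
end

section
/- Let n ≥ 1, K > 0, α > 0, and let A be the n×n real matrix A = −K·I + K·S + ((α+1)/α)K·E, where S is the subdiagonal shift matrix and E has a single 1 in position (0, n−1). Set q = ((α+1)/α)^{1/n}, λ = K(q − 1), and let v ∈ ℝⁿ be the vector with components vᵢ = qⁱ for i = 0, …, n−1. Then v is a left eigenvector of A for the eigenvalue λ, i.e., vᵀA = λ vᵀ. -/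
/-- With q = ((α+1)/α)^{1/n}, λ = K(q − 1), and v the vector with
components vᵢ = qⁱ, v is a left eigenvector of A = −K·I + K·S + ((α+1)/α)K·E
for the eigenvalue λ, i.e. vᵀA = λvᵀ. -/
theorem glyA_left_eigenvector (n : ℕ) (hn : 1 ≤ n) (K α : ℝ) (hK : 0 < K) (hα : 0 < α) :
    Matrix.vecMul (fun i : Fin n => (((α + 1) / α) ^ ((1 : ℝ) / n)) ^ (i : ℕ))
        (glyA n K α) =
      (K * (((α + 1) / α) ^ ((1 : ℝ) / n) - 1)) •
        (fun i : Fin n => (((α + 1) / α) ^ ((1 : ℝ) / n)) ^ (i : ℕ)) := by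
  have hq : (((α + 1) / α) ^ ((1 : ℝ) / n)) ^ n = (α + 1) / α := by
    rw [one_div]
    exact Real.rpow_inv_natCast_pow (by positivity) (by omega)
  generalize ((α + 1) / α) ^ ((1 : ℝ) / n) = q at hq ⊢
  unfold glyA
  rw [← hq, Matrix.vecMul_add, Matrix.vecMul_add, Matrix.vecMul_smul, Matrix.vecMul_smul,
    Matrix.vecMul_smul, Matrix.vecMul_one]
  ext j
  have hj := j.isLt
  simp only [Pi.add_apply, Pi.smul_apply, smul_eq_mul, Matrix.vecMul, dotProduct, subShift,
    cornerE, Matrix.of_apply, mul_ite, mul_one, mul_zero]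
  by_cases h : (j : ℕ) = n - 1
  · have h1 : ∑ x : Fin n, (if (x : ℕ) = (j : ℕ) + 1 then q ^ (x : ℕ) else 0) = 0 :=
      Finset.sum_eq_zero fun x _ => if_neg (by have := x.isLt; omega)
    have h2 : ∑ x : Fin n, (if (x : ℕ) = 0 ∧ (j : ℕ) = n - 1 then q ^ (x : ℕ) else 0) = 1 := by
      rw [Finset.sum_eq_single (⟨0, hn⟩ : Fin n)]
      · simp [h]
      · intro b _ hb
        exact if_neg fun hh => hb (Fin.ext hh.1)
      · simp
    rw [h1, h2]
    have h3 : q ^ n = q ^ (j : ℕ) * q := by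
      rw [← pow_succ]
      congr 1
      omega
    rw [h3]
    ring
  · have h1 : ∑ x : Fin n, (if (x : ℕ) = (j : ℕ) + 1 then q ^ (x : ℕ) else 0)
        = q ^ ((j : ℕ) + 1) := by
      rw [Finset.sum_eq_single (⟨(j : ℕ) + 1, by omega⟩ : Fin n)]
      · simp
      · intro b _ hb
        exact if_neg fun hh => hb (Fin.ext hh)
      · simp
    have h2 : ∑ x : Fin n, (if (x : ℕ) = 0 ∧ (j : ℕ) = n - 1 then q ^ (x : ℕ) else 0) = 0 :=
      Finset.sum_eq_zero fun x _ => if_neg fun hh => h hh.2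
    rw [h1, h2]
    ring
end

section
/- (Hard limit of Theorem 2, glycolysis with n intermediate reactions.) Let n ≥ 2, K > 0, α > 0, g ≥ 0. Let A = −K·I + K·S + ((α+1)/α)K·E be the n×n matrix with S the subdiagonal shift and E the single-entry matrix at (0, n−1); let B ∈ ℝⁿ have B₀ = K/α − ((α+1)/α)g, B₁ = −K/α, B_{n−1} = g (added entrywise; all other entries 0), and C ∈ ℝⁿ have C₀ = −1/α and all other entries 0. Set q = ((α+1)/α)^{1/n}, λ = K(q−1), and δ(t) = e^{−λt}. Suppose z : [0,∞) → ℝⁿ is differentiable with z′(t) = A z(t) + y(t) B + δ(t) C for all t ≥ 0, z(0) = 0, z(t) → 0 as t → ∞, and y is measurable with ∫₀^∞ y(t)² dt < ∞. Then ∫₀^∞ y(t)² dt ≥ Γ(α,K,g,n)² ∫₀^∞ δ(t)² dt, where Γ(α,K,g,n) = [(K + gα q^{n−1})(q − 1)]^{−1}. Hence the best achievable L²-gain γ* from δ to y satisfies γ* ≥ Γ(α,K,g,n). -/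
open MeasureTheory Filter

/-- The input vector B: B₀ = K/α − ((α+1)/α)g, B₁ = −K/α, B_{n−1} = g,
added entrywise. -/
noncomputable def glyB (n : ℕ) (K α g : ℝ) : Fin n → ℝ := fun i =>
  (if (i : ℕ) = 0 then K / α - ((α + 1) / α) * g else 0)
    + (if (i : ℕ) = 1 then -(K / α) else 0)
    + (if (i : ℕ) = n - 1 then g else 0)

/-- The disturbance vector C: C₀ = −1/α, all other entries 0. -/
noncomputable def glyC (n : ℕ) (α : ℝ) : Fin n → ℝ := fun i =>
  if (i : ℕ) = 0 then -(1 / α) else 0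

/-- q = ((α+1)/α)^{1/n}. -/
noncomputable def glyq (n : ℕ) (α : ℝ) : ℝ := ((α + 1) / α) ^ ((1 : ℝ) / n)

theorem gly_sum_single (n : ℕ) (q : ℝ) (k : ℕ) (c : ℝ) (hk : k < n) :
    ∑ i : Fin n, q ^ (i : ℕ) * (if (i : ℕ) = k then c else 0) = q ^ k * c := by
  rw [Finset.sum_eq_single (⟨k, hk⟩ : Fin n)]
  · simp
  · intro b _ hb
    have : (b : ℕ) ≠ k := fun h => hb (Fin.ext h)
    simp [this]
  · simp

theorem gly_left_eig (n : ℕ) (hn : 2 ≤ n) (K α q : ℝ) (hq : q ^ n = (α + 1) / α) :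
    Matrix.vecMul (fun i : Fin n => q ^ (i : ℕ)) (glyA n K α)
      = fun j : Fin n => (K * (q - 1)) * q ^ (j : ℕ) := by
  funext j
  have h1 : Matrix.vecMul (fun i : Fin n => q ^ (i : ℕ)) (1 : Matrix (Fin n) (Fin n) ℝ) j
      = q ^ (j : ℕ) := by rw [Matrix.vecMul_one]
  have h2 : Matrix.vecMul (fun i : Fin n => q ^ (i : ℕ)) (subShift n) j
      = if (j : ℕ) + 1 < n then q ^ ((j : ℕ) + 1) else 0 := by
    simp only [Matrix.vecMul, dotProduct, subShift, Matrix.of_apply]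
    split_ifs with h
    · rw [gly_sum_single n q _ 1 h, mul_one]
    · apply Finset.sum_eq_zero
      intro i _
      have : (i : ℕ) ≠ (j : ℕ) + 1 := by have := i.2; omega
      simp [this]
  have h3 : Matrix.vecMul (fun i : Fin n => q ^ (i : ℕ)) (cornerE n) j
      = if (j : ℕ) + 1 < n then 0 else 1 := by
    simp only [Matrix.vecMul, dotProduct, cornerE, Matrix.of_apply]
    split_ifs with h
    · apply Finset.sum_eq_zero
      intro i _
      have : ¬ ((i : ℕ) = 0 ∧ (j : ℕ) = n - 1) := by omega
      simp [this]
    · have hj : (j : ℕ) = n - 1 := by have := j.2; omega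
      have := gly_sum_single n q 0 1 (by omega)
      simpa [hj] using this
  unfold glyA
  rw [Matrix.vecMul_add, Matrix.vecMul_add, Matrix.vecMul_smul, Matrix.vecMul_smul,
    Matrix.vecMul_smul]
  simp only [Pi.add_apply, Pi.smul_apply, smul_eq_mul, h1, h2, h3]
  split_ifs with h
  · ring
  · have hj : n = (j : ℕ) + 1 := by have := j.2; omega
    have hq' : q ^ ((j : ℕ) + 1) = (α + 1) / α := by rw [← hj]; exact hq
    rw [← hq']
    ring

theorem gly_wB (n : ℕ) (hn : 2 ≤ n) (K α g q : ℝ) (hα : 0 < α) (hq : q ^ n = (α + 1) / α) :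
    (fun i : Fin n => q ^ (i : ℕ)) ⬝ᵥ glyB n K α g
      = -(((K + g * α * q ^ (n - 1)) * (q - 1)) / α) := by
  simp only [dotProduct, glyB, mul_add, Finset.sum_add_distrib]
  rw [gly_sum_single n q 0 _ (by omega), gly_sum_single n q 1 _ (by omega),
    gly_sum_single n q (n - 1) _ (by omega), ← hq]
  have : q ^ n = q ^ (n - 1) * q := by rw [← pow_succ]; congr 1; omega
  rw [this]
  field_simp
  ring

theorem gly_wC (n : ℕ) (hn : 2 ≤ n) (α q : ℝ) :
    (fun i : Fin n => q ^ (i : ℕ)) ⬝ᵥ glyC n α = -(1 / α) := by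
  simp only [dotProduct, glyC]
  rw [gly_sum_single n q 0 _ (by omega)]
  simp

/-- Hard limit of Theorem 2, glycolysis with n intermediate
reactions: with λ = K(q−1) and δ(t) = e^{−λt}, any solution of
z′ = Az + yB + δC with z(0) = 0, z(t) → 0 and square-integrable y satisfies
∫₀^∞ y² ≥ Γ(α,K,g,n)² ∫₀^∞ δ², where
Γ(α,K,g,n) = [(K + gα q^{n−1})(q − 1)]⁻¹; hence γ* ≥ Γ(α,K,g,n). -/
theorem glycolysis_n_intermediate_L2_gain_hard_limit
    (n : ℕ) (hn : 2 ≤ n) (K α g : ℝ) (hK : 0 < K) (hα : 0 < α) (hg : 0 ≤ g)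
    (z : ℝ → (Fin n → ℝ)) (y : ℝ → ℝ)
    (hz : ∀ t : ℝ, 0 ≤ t →
      HasDerivAt z
        ((glyA n K α).mulVec (z t) + y t • glyB n K α g
          + Real.exp (-(K * (glyq n α - 1)) * t) • glyC n α) t)
    (hz0 : z 0 = 0)
    (hy : Measurable y)
    (hyi : IntegrableOn (fun t => y t ^ 2) (Set.Ioi 0))
    (hlim : Tendsto z atTop (nhds 0)) :
    (∫ t in Set.Ioi (0 : ℝ), y t ^ 2) ≥
      (((K + g * α * glyq n α ^ (n - 1)) * (glyq n α - 1))⁻¹) ^ 2 *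
        ∫ t in Set.Ioi (0 : ℝ), (Real.exp (-(K * (glyq n α - 1)) * t)) ^ 2 := by
  have hn0 : (n : ℝ) ≠ 0 := by
    have : n ≠ 0 := by omega
    exact_mod_cast this
  have hr : 1 < (α + 1) / α := by rw [lt_div_iff₀ hα]; linarith
  have hqn : glyq n α ^ n = (α + 1) / α := by
    unfold glyq
    rw [← Real.rpow_natCast, ← Real.rpow_mul (by linarith), one_div, inv_mul_cancel₀ hn0,
      Real.rpow_one]
  have hq1 : 1 < glyq n α := by
    unfold glyq
    exact Real.one_lt_rpow hr (by positivity)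
  generalize glyq n α = q at *
  have hlam : 0 < K * (q - 1) := mul_pos hK (by linarith)
  have hM : 0 < (K + g * α * q ^ (n - 1)) * (q - 1) := by
    apply mul_pos _ (by linarith)
    have : 0 < q := by linarith
    positivity
  have hB := gly_wB n hn K α g q hα hqn
  have hC := gly_wC n hn α q
  have hA := gly_left_eig n hn K α q hqn
  generalize (K + g * α * q ^ (n - 1)) * (q - 1) = M at *
  generalize K * (q - 1) = l at *
  set w : Fin n → ℝ := fun i => q ^ (i : ℕ) with hw
  have hA' : ∀ x : Fin n → ℝ, w ⬝ᵥ (glyA n K α).mulVec x = l * (w ⬝ᵥ x) := by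
    intro x
    rw [Matrix.dotProduct_mulVec, hA]
    simp only [dotProduct, Finset.mul_sum, hw, mul_assoc]
  have hv : ∀ t : ℝ, 0 ≤ t → HasDerivAt (fun t => w ⬝ᵥ z t)
      (l * (w ⬝ᵥ z t) - M / α * y t - Real.exp (-l * t) / α) t := by
    intro t ht
    have h1 := hasDerivAt_pi.1 (hz t ht)
    have h2 := HasDerivAt.fun_sum (u := Finset.univ) fun i _ => (h1 i).const_mul (w i)
    have h3 : w ⬝ᵥ ((glyA n K α).mulVec (z t) + y t • glyB n K α g
          + Real.exp (-l * t) • glyC n α)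
        = l * (w ⬝ᵥ z t) - M / α * y t - Real.exp (-l * t) / α := by
      rw [dotProduct_add, dotProduct_add, dotProduct_smul, dotProduct_smul, hA', hB, hC]
      simp only [smul_eq_mul]
      ring
    rw [← h3]
    exact h2
  have hF : ∀ t : ℝ, 0 ≤ t → HasDerivAt (fun t => Real.exp (-l * t) * (w ⬝ᵥ z t))
      (-(M / α) * (Real.exp (-l * t) * y t) - (1 / α) * Real.exp (-l * t) ^ 2) t := by
    intro t ht
    have he : HasDerivAt (fun t => Real.exp (-l * t)) (Real.exp (-l * t) * (-l * 1)) t :=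
      ((hasDerivAt_id t).const_mul (-l)).exp
    exact (he.fun_mul (hv t ht)).congr_deriv (by ring)
  have hd2 : IntegrableOn (fun t => Real.exp (-l * t) ^ 2) (Set.Ioi 0) := by
    have : (fun t : ℝ => Real.exp (-l * t) ^ 2) = fun t => Real.exp (-(2 * l) * t) := by
      funext t
      rw [← Real.exp_nat_mul]
      congr 1
      push_cast
      ring
    rw [this]
    exact exp_neg_integrableOn_Ioi 0 (by linarith)
  have hdm : Measurable (fun t : ℝ => Real.exp (-l * t)) := by fun_prop
  have hdy : IntegrableOn (fun t => Real.exp (-l * t) * y t) (Set.Ioi 0) := by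
    have h1 : MemLp (fun t : ℝ => Real.exp (-l * t)) 2 (volume.restrict (Set.Ioi 0)) :=
      (memLp_two_iff_integrable_sq hdm.aestronglyMeasurable).2 hd2
    have h2 : MemLp y 2 (volume.restrict (Set.Ioi 0)) :=
      (memLp_two_iff_integrable_sq hy.aestronglyMeasurable).2 hyi
    exact h1.integrable_mul h2
  have hl1 : Tendsto (fun t => w ⬝ᵥ z t) atTop (nhds 0) := by
    have hc : Continuous (fun x : Fin n → ℝ => w ⬝ᵥ x) := by
      unfold dotProduct
      fun_prop
    have := (hc.tendsto 0).comp hlim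
    rw [dotProduct_zero] at this
    exact this
  have hl2 : Tendsto (fun t : ℝ => Real.exp (-l * t)) atTop (nhds 0) := by
    apply Real.tendsto_exp_atBot.comp
    exact tendsto_id.const_mul_atTop_of_neg (by linarith)
  have hl3 : Tendsto (fun t => Real.exp (-l * t) * (w ⬝ᵥ z t)) atTop (nhds 0) := by
    simpa using hl2.mul hl1
  have hI := integral_Ioi_of_hasDerivAt_of_tendsto' (a := 0) (fun t ht => hF t ht)
    ((hdy.const_mul (-(M / α))).sub (hd2.const_mul (1 / α))) hl3
  rw [integral_sub (hdy.const_mul (-(M / α))) (hd2.const_mul (1 / α)),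
    integral_const_mul, integral_const_mul, hz0] at hI
  simp only [dotProduct_zero, mul_zero, sub_zero] at hI
  have hsq : 0 ≤ ∫ t in Set.Ioi (0 : ℝ), (y t + M⁻¹ * Real.exp (-l * t)) ^ 2 :=
    integral_nonneg fun t => sq_nonneg _
  have hexp : ∫ t in Set.Ioi (0 : ℝ), (y t + M⁻¹ * Real.exp (-l * t)) ^ 2
      = (∫ t in Set.Ioi (0 : ℝ), y t ^ 2)
        + (2 * M⁻¹) * (∫ t in Set.Ioi (0 : ℝ), Real.exp (-l * t) * y t)
        + M⁻¹ ^ 2 * ∫ t in Set.Ioi (0 : ℝ), Real.exp (-l * t) ^ 2 := by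
    have hs : Integrable (fun a => y a ^ 2 + 2 * M⁻¹ * (Real.exp (-l * a) * y a))
        (volume.restrict (Set.Ioi 0)) := Integrable.add hyi (hdy.const_mul (2 * M⁻¹))
    rw [← integral_const_mul, ← integral_const_mul, ← integral_add hyi (hdy.const_mul _),
      ← integral_add hs (hd2.const_mul _)]
    congr 1
    funext t
    ring
  rw [hexp] at hsq
  generalize (∫ t in Set.Ioi (0 : ℝ), y t ^ 2) = Y at *
  generalize (∫ t in Set.Ioi (0 : ℝ), Real.exp (-l * t) * y t) = P at *
  generalize (∫ t in Set.Ioi (0 : ℝ), Real.exp (-l * t) ^ 2) = D at *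
  have hP : P = -(M⁻¹ * D) := by
    field_simp at hI ⊢
    linarith
  rw [hP] at hsq
  nlinarith [hsq]
end

section
/- (Hard limit of Theorem 4, minimum output energy with n intermediate reactions.) Let n ≥ 2, K > 0, α > 0, g ≥ 0. Let A = −K·I + K·S + ((α+1)/α)K·E be the n×n matrix with S the subdiagonal shift and E the single-entry matrix at (0, n−1), and let B ∈ ℝⁿ have B₀ = K/α − ((α+1)/α)g, B₁ = −K/α, B_{n−1} = g (added entrywise; other entries 0). Set q = ((α+1)/α)^{1/n}. Suppose z : [0,∞) → ℝⁿ is differentiable with z′(t) = A z(t) + y(t) B for all t ≥ 0, z(0) = z₀, z(t) → 0 as t → ∞, and y is measurable with ∫₀^∞ y(t)² dt < ∞. Then ∫₀^∞ y(t)² dt ≥ 2α²K (Σ_{i=0}^{n−1} qⁱ (z₀)ᵢ)² / [(q − 1)(K + gα q^{n−1})²]; in particular ∫₀^∞ y(t)² dt ≥ α²K (Σ_{i=0}^{n−1} qⁱ (z₀)ᵢ)² / [(q − 1)(K + gα q^{n−1})²]. -/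
open MeasureTheory Filter

lemma gly_scalar (w y : ℝ → ℝ) (l b : ℝ) (hl : 0 < l)
    (hw : ∀ t : ℝ, 0 ≤ t → HasDerivAt w (l * w t + b * y t) t)
    (hyi : IntegrableOn (fun t => y t ^ 2) (Set.Ioi 0))
    (hlim : Tendsto w atTop (nhds 0)) :
    2 * l * w 0 ^ 2 ≤ b ^ 2 * ∫ t in Set.Ioi (0 : ℝ), y t ^ 2 := by
  have key : ∀ T : ℝ, 0 ≤ T →
      2 * l * w 0 ^ 2 - 2 * l * w T ^ 2 ≤ b ^ 2 * ∫ t in Set.Ioi (0 : ℝ), y t ^ 2 := by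
    intro T hT
    have hd : ∀ t : ℝ, 0 ≤ t → HasDerivAt (fun s => -(2 * l) * w s ^ 2)
        (-(2 * l) * (2 * w t * (l * w t + b * y t))) t := by
      intro t ht
      have := ((hw t ht).pow 2).const_mul (-(2 * l))
      refine this.congr_deriv ?_
      norm_num
    have hI : IntegrableOn (fun t => b ^ 2 * y t ^ 2) (Set.Ioi 0) := hyi.const_mul _
    have h1 := intervalIntegral.sub_le_integral_of_hasDeriv_right_of_le (a := 0) (b := T)
      (g := fun s => -(2 * l) * w s ^ 2)
      (g' := fun t => -(2 * l) * (2 * w t * (l * w t + b * y t)))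
      (φ := fun t => b ^ 2 * y t ^ 2) hT
      (fun t ht => (hd t ht.1).continuousAt.continuousWithinAt)
      (fun t ht => (hd t ht.1.le).hasDerivWithinAt)
      (by
        rw [integrableOn_Icc_iff_integrableOn_Ioc]
        exact hI.mono_set Set.Ioc_subset_Ioi_self)
      (fun t _ => by nlinarith [sq_nonneg (b * y t + 2 * l * w t)])
    have h2 : (∫ t in (0 : ℝ)..T, b ^ 2 * y t ^ 2) ≤ ∫ t in Set.Ioi (0 : ℝ), b ^ 2 * y t ^ 2 := by
      rw [intervalIntegral.integral_of_le hT]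
      exact setIntegral_mono_set hI (Eventually.of_forall fun t => by positivity)
        (Eventually.of_forall Set.Ioc_subset_Ioi_self)
    rw [integral_const_mul] at h2
    linarith
  have hL : Tendsto (fun T => 2 * l * w 0 ^ 2 - 2 * l * w T ^ 2) atTop
      (nhds (2 * l * w 0 ^ 2 - 2 * l * 0 ^ 2)) :=
    tendsto_const_nhds.sub ((hlim.pow 2).const_mul _)
  have := le_of_tendsto hL ((eventually_ge_atTop 0).mono key)
  simpa using this

lemma gly_vA (n : ℕ) (hn : 2 ≤ n) (K α q : ℝ) (hq : q ^ n = (α + 1) / α) (x : Fin n → ℝ) :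
    ∑ i : Fin n, q ^ (i : ℕ) * (glyA n K α).mulVec x i
      = K * (q - 1) * ∑ i : Fin n, q ^ (i : ℕ) * x i := by
  obtain ⟨m, rfl⟩ : ∃ m, n = m + 1 := ⟨n - 1, by omega⟩
  have hS : ∀ j : Fin (m + 1), ∑ i : Fin (m + 1), q ^ (i : ℕ) * glyA (m + 1) K α i j
      = K * (q - 1) * q ^ (j : ℕ) := by
    intro j
    have e1 : ∑ i : Fin (m + 1), q ^ (i : ℕ) * (1 : Matrix (Fin (m + 1)) (Fin (m + 1)) ℝ) i j
        = q ^ (j : ℕ) := by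
      simp [Matrix.one_apply]
    have e2 : ∑ i : Fin (m + 1), q ^ (i : ℕ) * cornerE (m + 1) i j
        = if (j : ℕ) = m then 1 else 0 := by
      rw [Fin.sum_univ_succ]
      simp [cornerE]
    have e3 : ∑ i : Fin (m + 1), q ^ (i : ℕ) * subShift (m + 1) i j
        = if (j : ℕ) = m then 0 else q ^ ((j : ℕ) + 1) := by
      split_ifs with h
      · apply Finset.sum_eq_zero
        intro i _
        have : ¬ ((i : ℕ) = (j : ℕ) + 1) := by omega
        simp [subShift, this]
      · rw [Finset.sum_eq_single (⟨(j : ℕ) + 1, by omega⟩ : Fin (m + 1))]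
        · simp [subShift]
        · intro i _ hi
          have : ¬ ((i : ℕ) = (j : ℕ) + 1) := fun h => hi (Fin.ext h)
          simp [subShift, this]
        · simp
    have : ∑ i : Fin (m + 1), q ^ (i : ℕ) * glyA (m + 1) K α i j
        = -K * ∑ i : Fin (m + 1), q ^ (i : ℕ) * (1 : Matrix (Fin (m + 1)) (Fin (m + 1)) ℝ) i j
          + K * ∑ i : Fin (m + 1), q ^ (i : ℕ) * subShift (m + 1) i j
          + ((α + 1) / α * K) * ∑ i : Fin (m + 1), q ^ (i : ℕ) * cornerE (m + 1) i j := by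
      simp only [Finset.mul_sum, ← Finset.sum_add_distrib]
      refine Finset.sum_congr rfl fun i _ => ?_
      simp only [glyA, Matrix.add_apply, Matrix.smul_apply, smul_eq_mul]
      ring
    rw [this, e1, e2, e3, ← hq]
    split_ifs with h
    · rw [h]; ring
    · ring
  simp only [Matrix.mulVec, dotProduct, Finset.mul_sum]
  rw [Finset.sum_comm]
  refine Finset.sum_congr rfl fun j _ => ?_
  rw [← mul_assoc, ← hS j, Finset.sum_mul]
  exact Finset.sum_congr rfl fun i _ => by ring

lemma gly_vB (n : ℕ) (hn : 2 ≤ n) (K α g q : ℝ) (hq : q ^ n = (α + 1) / α) :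
    ∑ i : Fin n, q ^ (i : ℕ) * glyB n K α g i
      = -((q - 1) * (K / α + g * q ^ (n - 1))) := by
  obtain ⟨m, rfl⟩ : ∃ m, n = m + 2 := ⟨n - 2, by omega⟩
  have hs : ∀ (k : ℕ) (c : ℝ), k < m + 2 →
      ∑ i : Fin (m + 2), q ^ (i : ℕ) * (if (i : ℕ) = k then c else 0) = q ^ k * c := by
    intro k c hk
    rw [Finset.sum_eq_single (⟨k, hk⟩ : Fin (m + 2))]
    · simp
    · intro i _ hi
      have : ¬ ((i : ℕ) = k) := fun h => hi (Fin.ext h)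
      simp [this]
    · simp
  simp only [glyB, mul_add, Finset.sum_add_distrib]
  rw [hs 0 _ (by omega), hs 1 _ (by omega), hs (m + 2 - 1) _ (by omega), ← hq]
  simp only [Nat.add_succ_sub_one]
  ring

/-- Hard limit of Theorem 4, minimum output energy with n
intermediate reactions: any solution of z′ = Az + yB with z(0) = z₀,
z(t) → 0 and square-integrable y satisfies
∫₀^∞ y² ≥ 2α²K (Σᵢ qⁱ(z₀)ᵢ)² / [(q−1)(K + gα q^{n−1})²]; in particular
∫₀^∞ y² ≥ α²K (Σᵢ qⁱ(z₀)ᵢ)² / [(q−1)(K + gα q^{n−1})²]. -/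
theorem glycolysis_n_intermediate_min_output_energy
    (n : ℕ) (hn : 2 ≤ n) (K α g : ℝ) (hK : 0 < K) (hα : 0 < α) (hg : 0 ≤ g)
    (z₀ : Fin n → ℝ) (z : ℝ → (Fin n → ℝ)) (y : ℝ → ℝ)
    (hz : ∀ t : ℝ, 0 ≤ t →
      HasDerivAt z ((glyA n K α).mulVec (z t) + y t • glyB n K α g) t)
    (hz0 : z 0 = z₀)
    (hy : Measurable y)
    (hyi : IntegrableOn (fun t => y t ^ 2) (Set.Ioi 0))
    (hlim : Tendsto z atTop (nhds 0)) :
    (∫ t in Set.Ioi (0 : ℝ), y t ^ 2) ≥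
        2 * α ^ 2 * K * (∑ i : Fin n, glyq n α ^ (i : ℕ) * z₀ i) ^ 2 /
          ((glyq n α - 1) * (K + g * α * glyq n α ^ (n - 1)) ^ 2) ∧
      (∫ t in Set.Ioi (0 : ℝ), y t ^ 2) ≥
        α ^ 2 * K * (∑ i : Fin n, glyq n α ^ (i : ℕ) * z₀ i) ^ 2 /
          ((glyq n α - 1) * (K + g * α * glyq n α ^ (n - 1)) ^ 2) := by
  set q := glyq n α with hqdef
  have hr : 1 < (α + 1) / α := by rw [lt_div_iff₀ hα]; linarith
  have hq1 : 1 < q := Real.one_lt_rpow hr (by positivity)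
  have hqn : q ^ n = (α + 1) / α := by
    rw [hqdef, glyq, one_div]
    exact Real.rpow_inv_natCast_pow (by positivity) (by omega)
  have hmain := gly_scalar (fun t => ∑ i : Fin n, q ^ (i : ℕ) * z t i) y (K * (q - 1))
    (-((q - 1) * (K / α + g * q ^ (n - 1)))) (mul_pos hK (by linarith))
    (by
      intro t ht
      have h1 := hasDerivAt_pi.1 (hz t ht)
      have h2 := HasDerivAt.fun_sum (u := Finset.univ)
        fun i _ => (h1 i).const_mul (q ^ (i : ℕ))
      refine h2.congr_deriv ?_
      symm
      rw [← gly_vA n hn K α q hqn, ← gly_vB n hn K α g q hqn, Finset.sum_mul,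
        ← Finset.sum_add_distrib]
      refine Finset.sum_congr rfl fun i _ => ?_
      simp only [Pi.add_apply, Pi.smul_apply, smul_eq_mul]
      ring)
    hyi
    (by
      have h1 := tendsto_pi_nhds.1 hlim
      have h2 := tendsto_finsetSum Finset.univ
        fun i _ => (h1 i).const_mul (q ^ (i : ℕ))
      simpa using h2)
  simp only [hz0] at hmain
  set I := ∫ t in Set.Ioi (0 : ℝ), y t ^ 2
  set W := ∑ i : Fin n, q ^ (i : ℕ) * z₀ i
  have hq0 : 0 < q - 1 := by linarith
  have hP : 0 < K + g * α * q ^ (n - 1) := by positivity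
  have hfirst : 2 * α ^ 2 * K * W ^ 2 / ((q - 1) * (K + g * α * q ^ (n - 1)) ^ 2) ≤ I := by
    rw [div_le_iff₀ (by positivity)]
    have e : (K / α + g * q ^ (n - 1)) = (K + g * α * q ^ (n - 1)) / α := by
      field_simp
    rw [e] at hmain
    generalize K + g * α * q ^ (n - 1) = P at *
    have h3 : (-((q - 1) * (P / α))) ^ 2 * I = (q - 1) / α ^ 2 * (I * ((q - 1) * P ^ 2)) := by
      field_simp
    have h4 : 2 * (K * (q - 1)) * W ^ 2 = (q - 1) / α ^ 2 * (2 * α ^ 2 * K * W ^ 2) := by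
      field_simp
    rw [h3, h4] at hmain
    exact le_of_mul_le_mul_left hmain (by positivity)
  refine ⟨hfirst, le_trans ?_ hfirst⟩
  gcongr
  nlinarith [sq_nonneg α]
end

section
/- (Linear growth of the minimum-energy hard limit.) Fix α > 0, K > 0, g ≥ 0, and for n ≥ 1 set q_n = ((α+1)/α)^{1/n} and c_n = α²K / [(q_n − 1)(K + gα q_n^{n−1})²]. Then lim_{n→∞} c_n/n = α²K / [ln(1 + 1/α) · (K + g(α+1))²]. -/
open Filter

/-- The coefficient c_n = α²K / [(q_n − 1)(K + gα q_n^{n−1})²] of the squared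
initial offset in the minimum output-energy hard limit. -/
noncomputable def glyCoeff (α K g : ℝ) (n : ℕ) : ℝ :=
  α ^ 2 * K / ((glyq n α - 1) * (K + g * α * glyq n α ^ (n - 1)) ^ 2)

/-- Linear growth of the minimum-energy hard limit:
lim_{n→∞} c_n/n = α²K / [ln(1+1/α)·(K+g(α+1))²]. -/
theorem glyCoeff_linear_growth (α K g : ℝ) (hα : 0 < α) (hK : 0 < K) (hg : 0 ≤ g) :
    Tendsto (fun n : ℕ => glyCoeff α K g n / n) atTop
      (nhds (α ^ 2 * K / (Real.log (1 + 1 / α) * (K + g * (α + 1)) ^ 2))) := by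
  set r : ℝ := (α + 1) / α with hr
  have hr0 : 0 < r := by positivity
  have hr1 : 1 + 1 / α = r := by rw [hr]; field_simp
  have hr2 : 1 < r := by rw [← hr1]; have : 0 < 1 / α := by positivity
                         linarith
  have hlog : 0 < Real.log r := Real.log_pos hr2
  have hinv : Tendsto (fun n : ℕ => (1 : ℝ) / n) atTop (nhds 0) :=
    tendsto_one_div_atTop_nhds_zero_nat
  have hq : Tendsto (fun n : ℕ => glyq n α) atTop (nhds 1) := by
    have h := (Real.continuous_const_rpow hr0.ne').tendsto 0
    rw [Real.rpow_zero] at h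
    exact h.comp hinv
  have hd : Tendsto (fun n : ℕ => (n : ℝ) * (glyq n α - 1)) atTop (nhds (Real.log r)) := by
    have h : HasDerivAt (fun x : ℝ => r ^ x) (Real.log r) 0 := by
      have := (Real.hasStrictDerivAt_const_rpow hr0 0).hasDerivAt
      simpa using this
    rw [hasDerivAt_iff_tendsto_slope] at h
    have hinv' : Tendsto (fun n : ℕ => (1 : ℝ) / n) atTop (nhdsWithin 0 {0}ᶜ) := by
      refine tendsto_nhdsWithin_iff.2 ⟨hinv, ?_⟩
      filter_upwards [eventually_gt_atTop 0] with n hn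
      have : (n : ℝ) ≠ 0 := by positivity
      simpa using hn.ne'
    refine (h.comp hinv').congr fun n => ?_
    simp [slope, glyq, hr]
  have hp : Tendsto (fun n : ℕ => glyq n α ^ (n - 1)) atTop (nhds r) := by
    have h := (tendsto_const_nhds (x := r)).div hq one_ne_zero
    rw [div_one] at h
    refine h.congr' ?_
    filter_upwards [eventually_gt_atTop 0] with n hn
    have hq0 : 0 < glyq n α := Real.rpow_pos_of_pos hr0 _
    have hqn : glyq n α ^ n = r := by
      unfold glyq
      rw [one_div]
      exact Real.rpow_inv_natCast_pow hr0.le hn.ne'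
    simp only [Pi.div_apply]
    rw [div_eq_iff hq0.ne', ← pow_succ, Nat.sub_add_cancel hn, hqn]
  have hαr : K + g * (α + 1) = K + g * α * r := by rw [hr]; field_simp
  rw [hr1, hαr]
  have hne : Real.log r * (K + g * α * r) ^ 2 ≠ 0 := by positivity
  refine ((tendsto_const_nhds (x := α ^ 2 * K)).div
    (hd.mul (((hp.const_mul (g * α)).const_add K).pow 2)) hne).congr fun n => ?_
  simp only [glyCoeff, Pi.div_apply]
  rw [div_div]
  congr 1
  ring
end

section
/- Let n ≥ 1, a ∈ ℝ, α > 0, and let g₀, …, g_{n−1} > 0. Let A₀ be the n×n real matrix with (A₀)ᵢᵢ = −a, (A₀)_{i+1,i} = gᵢ for 0 ≤ i ≤ n−2, corner entry g_{n−1}/α added at position (0, n−1), and zeros elsewhere. Set r = ((g₀ g₁ ⋯ g_{n−1})/α)^{1/n} and let v ∈ ℝⁿ have components v₀ = 1 and vⱼ = rʲ/(g₀ g₁ ⋯ g_{j−1}) for 1 ≤ j ≤ n−1. Then v is a left eigenvector of A₀ for the eigenvalue r − a, i.e., vᵀA₀ = (r − a) vᵀ. -/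
/-- The linearized zero-dynamics matrix A₀ of a general autocatalytic cyclic
network: diagonal entries −a, subdiagonal entries (A₀)_{i+1,i} = gᵢ, and
corner entry g_{n−1}/α added at position (0, n−1). -/
noncomputable def cyclicA (n : ℕ) (a α : ℝ) (gs : Fin n → ℝ) :
    Matrix (Fin n) (Fin n) ℝ :=
  Matrix.of fun i j =>
    (if i = j then -a else 0)
      + (if (i : ℕ) = (j : ℕ) + 1 then gs j else 0)
      + (if (i : ℕ) = 0 ∧ (j : ℕ) = n - 1 then gs j / α else 0)

/-- With r = ((g₀g₁⋯g_{n−1})/α)^{1/n} and v the vector with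
v₀ = 1 and vⱼ = rʲ/(g₀g₁⋯g_{j−1}), v is a left eigenvector of A₀ for the
eigenvalue r − a, i.e. vᵀA₀ = (r − a)vᵀ. -/
theorem cyclicA_left_eigenvector (n : ℕ) (hn : 1 ≤ n) (a α : ℝ) (hα : 0 < α)
    (gs : Fin n → ℝ) (hgs : ∀ i, 0 < gs i) :
    Matrix.vecMul
        (fun j : Fin n =>
          (((∏ i : Fin n, gs i) / α) ^ ((1 : ℝ) / n)) ^ (j : ℕ) /
            ∏ i ∈ Finset.univ.filter (fun i : Fin n => (i : ℕ) < (j : ℕ)), gs i)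
        (cyclicA n a α gs) =
      ((((∏ i : Fin n, gs i) / α) ^ ((1 : ℝ) / n)) - a) •
        (fun j : Fin n =>
          (((∏ i : Fin n, gs i) / α) ^ ((1 : ℝ) / n)) ^ (j : ℕ) /
            ∏ i ∈ Finset.univ.filter (fun i : Fin n => (i : ℕ) < (j : ℕ)), gs i) := by
  have hP : ∀ i : Fin n, ∏ k ∈ Finset.univ.filter (fun k : Fin n => (k : ℕ) < (i : ℕ) + 1), gs k
      = gs i * ∏ k ∈ Finset.univ.filter (fun k : Fin n => (k : ℕ) < (i : ℕ)), gs k := by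
    intro i
    rw [← Finset.prod_insert (by simp)]
    congr 1
    ext k
    simp only [Finset.mem_filter, Finset.mem_univ, true_and, Finset.mem_insert, Fin.ext_iff]
    omega
  have hpos : ∀ m : ℕ, 0 < ∏ k ∈ Finset.univ.filter (fun k : Fin n => (k : ℕ) < m), gs k :=
    fun m => Finset.prod_pos fun k _ => hgs k
  have hr : (((∏ i : Fin n, gs i) / α) ^ ((1 : ℝ) / n)) ^ n = (∏ i : Fin n, gs i) / α := by
    rw [one_div]
    exact Real.rpow_inv_natCast_pow
      (div_nonneg (Finset.prod_nonneg fun k _ => (hgs k).le) hα.le) (by omega)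
  generalize ((∏ i : Fin n, gs i) / α) ^ ((1 : ℝ) / n) = r at hr ⊢
  funext j
  simp only [Matrix.vecMul, dotProduct, cyclicA, Matrix.of_apply, mul_add,
    Finset.sum_add_distrib, Pi.smul_apply, smul_eq_mul]
  have h1 : ∀ f : Fin n → ℝ, ∑ x, f x * (if x = j then -a else 0) = f j * (-a) := by
    intro f; simp
  rw [h1]
  have hj := hgs j
  have hPj := hpos j
  by_cases hl : (j : ℕ) + 1 < n
  · rw [Finset.sum_eq_single (⟨(j : ℕ) + 1, hl⟩ : Fin n), Finset.sum_eq_zero]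
    · simp only [if_true]
      rw [hP j]
      field_simp
      ring
    · intro x _
      rw [if_neg (by omega), mul_zero]
    · intro x _ hx
      rw [if_neg (fun h => hx (Fin.ext h)), mul_zero]
    · simp
  · have hjn : (j : ℕ) + 1 = n := by omega
    rw [Finset.sum_eq_zero, Finset.sum_eq_single (⟨0, hn⟩ : Fin n)]
    · rw [if_pos ⟨rfl, by omega⟩]
      have hT : ∏ i : Fin n, gs i
          = gs j * ∏ k ∈ Finset.univ.filter (fun k : Fin n => (k : ℕ) < (j : ℕ)), gs k := by
        rw [← hP j]
        congr 1
        ext k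
        simp only [Finset.mem_filter, Finset.mem_univ, true_and, true_iff]
        omega
      have hr2 : r ^ (j : ℕ) * r = (gs j *
          ∏ k ∈ Finset.univ.filter (fun k : Fin n => (k : ℕ) < (j : ℕ)), gs k) / α := by
        rw [← hT, ← hr, ← pow_succ, hjn]
      simp only [pow_zero, Nat.not_lt_zero, Finset.filter_false, Finset.prod_empty]
      generalize (∏ k ∈ Finset.univ.filter (fun k : Fin n => (k : ℕ) < (j : ℕ)), gs k) = P at *
      have h3 : gs j / α = r ^ (j : ℕ) * r / P := by
        rw [hr2]; field_simp
      rw [h3]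
      ring
    · intro x _ hx
      rw [if_neg (fun h => hx (Fin.ext h.1)), mul_zero]
    · simp
    · intro x _
      rw [if_neg (by omega), mul_zero]
end

section
/- (Hard limit of Theorem 5, general autocatalytic cyclic network.) Let a ∈ ℝ, α > 0, f ≥ 0 and r > a. Let δ(t) = e^{−(r−a)t}. Suppose z : [0,∞) → ℝ is differentiable with z′(t) = (r − a) z(t) + ((a − f − r)/α) y(t) + (1/α) δ(t) for all t ≥ 0, z(0) = 0, z(t) → 0 as t → ∞, and y is measurable with ∫₀^∞ y(t)² dt < ∞. Then ∫₀^∞ y(t)² dt ≥ (f + r − a)^{−2} ∫₀^∞ δ(t)² dt. Hence the best achievable L²-gain γ* from the disturbance δ to the output y satisfies γ* ≥ 1/(f + r − a). -/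
open MeasureTheory Filter

/-- Hard limit of Theorem 5, general autocatalytic cyclic
network: For a ∈ ℝ, α > 0, f ≥ 0, r > a and the disturbance δ(t) = e^{−(r−a)t},
any solution of z′ = (r−a)z + ((a−f−r)/α)y + (1/α)δ with z(0) = 0, z(t) → 0,
and square-integrable y satisfies ∫₀^∞ y² ≥ (f+r−a)⁻² ∫₀^∞ δ²; hence the
best achievable L²-gain γ* satisfies γ* ≥ 1/(f+r−a). -/
theorem cyclic_network_L2_gain_hard_limit (a α f r : ℝ)
    (hα : 0 < α) (hf : 0 ≤ f) (hr : a < r)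
    (z y : ℝ → ℝ)
    (hz : ∀ t : ℝ, 0 ≤ t →
      HasDerivAt z
        ((r - a) * z t + ((a - f - r) / α) * y t
          + (1 / α) * Real.exp (-(r - a) * t)) t)
    (hz0 : z 0 = 0)
    (hy : Measurable y)
    (hyi : IntegrableOn (fun t => y t ^ 2) (Set.Ioi 0))
    (hlim : Tendsto z atTop (nhds 0)) :
    (∫ t in Set.Ioi (0 : ℝ), y t ^ 2) ≥
      ((f + r - a) ^ 2)⁻¹ * ∫ t in Set.Ioi (0 : ℝ), (Real.exp (-(r - a) * t)) ^ 2 := by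
  have hc : 0 < r - a := sub_pos.mpr hr
  have hk : 0 < f + r - a := by linarith
  have hE2 : IntegrableOn (fun t : ℝ => (Real.exp (-(r - a) * t)) ^ 2) (Set.Ioi 0) := by
    have h := integrableOn_exp_mul_Ioi (a := -(2 * (r - a))) (by linarith) 0
    refine h.congr_fun (fun t _ => ?_) measurableSet_Ioi
    simp only
    rw [← Real.exp_nat_mul]
    congr 1
    push_cast
    ring
  have hEy : IntegrableOn (fun t : ℝ => Real.exp (-(r - a) * t) * y t) (Set.Ioi 0) := by
    refine Integrable.mono' (hE2.add hyi) ?_ ?_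
    · exact (Measurable.mul (by fun_prop) hy).aestronglyMeasurable
    · refine Eventually.of_forall fun t => ?_
      simp only [Pi.add_apply, Real.norm_eq_abs]
      rw [abs_le]
      constructor <;> nlinarith [sq_nonneg (Real.exp (-(r - a) * t) + y t),
        sq_nonneg (Real.exp (-(r - a) * t) - y t), sq_nonneg (y t),
        sq_nonneg (Real.exp (-(r - a) * t))]
  have hderiv : ∀ t ∈ Set.Ici (0 : ℝ),
      HasDerivAt (fun t => α * (Real.exp (-(r - a) * t) * z t))
        ((Real.exp (-(r - a) * t)) ^ 2
          - (f + r - a) * (Real.exp (-(r - a) * t) * y t)) t := by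
    intro t ht
    have h1 : HasDerivAt (fun t : ℝ => Real.exp (-(r - a) * t))
        (Real.exp (-(r - a) * t) * (-(r - a) * 1)) t :=
      ((hasDerivAt_id t).const_mul (-(r - a))).exp
    refine ((h1.mul (hz t ht)).const_mul α).congr_deriv ?_
    generalize Real.exp (-(r - a) * t) = e
    field_simp
    ring
  have htend : Tendsto (fun t => α * (Real.exp (-(r - a) * t) * z t)) atTop (nhds 0) := by
    have h1 : Tendsto (fun t : ℝ => Real.exp (-(r - a) * t)) atTop (nhds 0) :=
      Real.tendsto_exp_atBot.comp
        (tendsto_id.const_mul_atTop_of_neg (by linarith : -(r - a) < 0))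
    simpa using (h1.mul hlim).const_mul α
  have hint := integral_Ioi_of_hasDerivAt_of_tendsto' hderiv
    (hE2.sub (hEy.const_mul (f + r - a))) htend
  rw [integral_sub hE2 (hEy.const_mul (f + r - a)), integral_const_mul, hz0] at hint
  have hsq : 0 ≤ ∫ t in Set.Ioi (0 : ℝ), ((f + r - a) ^ 2 * y t ^ 2
      - (2 * (f + r - a) * (Real.exp (-(r - a) * t) * y t)
        - (Real.exp (-(r - a) * t)) ^ 2)) := by
    refine integral_nonneg fun t => ?_
    simp only [Pi.zero_apply]
    nlinarith [sq_nonneg ((f + r - a) * y t - Real.exp (-(r - a) * t))]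
  have hD : IntegrableOn (fun t : ℝ => 2 * (f + r - a) * (Real.exp (-(r - a) * t) * y t)
        - (Real.exp (-(r - a) * t)) ^ 2) (Set.Ioi 0) := (hEy.const_mul _).sub hE2
  rw [integral_sub (hyi.const_mul _) hD,
    integral_sub (hEy.const_mul _) hE2, integral_const_mul, integral_const_mul] at hsq
  rw [ge_iff_le, inv_mul_le_iff₀ (by positivity)]
  linarith
end

section
/- (Hard limit of Example 2, glycolysis with ATP-dependent consumption.) Let α > 0, k > 0, k_y ≥ 0, and let δ(t) = e^{−(k/α)t}. Suppose z : [0,∞) → ℝ is differentiable with z′(t) = (k/α) z(t) − ((k + α k_y)/α²) y(t) − (1/α) δ(t) for all t ≥ 0, z(0) = 0, z(t) → 0 as t → ∞, and y is measurable with ∫₀^∞ y(t)² dt < ∞. Then ∫₀^∞ y(t)² dt ≥ (α/(k + α k_y))² ∫₀^∞ δ(t)² dt. Hence the best achievable L²-gain γ from δ to y satisfies γ ≥ α/(k + α k_y). -/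
open MeasureTheory Filter

/-- Hard limit of Example 2, glycolysis with ATP-dependent
consumption: For α > 0, k > 0, k_y ≥ 0 and the disturbance δ(t) = e^{−(k/α)t},
any solution of z′ = (k/α)z − ((k + αk_y)/α²)y − (1/α)δ with z(0) = 0,
z(t) → 0, and square-integrable y satisfies
∫₀^∞ y² ≥ (α/(k + αk_y))² ∫₀^∞ δ²; hence γ ≥ α/(k + αk_y). -/
theorem glycolysis_ATP_dependent_consumption_hard_limit (α k ky : ℝ)
    (hα : 0 < α) (hk : 0 < k) (hky : 0 ≤ ky)
    (z y : ℝ → ℝ)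
    (hz : ∀ t : ℝ, 0 ≤ t →
      HasDerivAt z
        ((k / α) * z t - ((k + α * ky) / α ^ 2) * y t
          - (1 / α) * Real.exp (-(k / α) * t)) t)
    (hz0 : z 0 = 0)
    (hy : Measurable y)
    (hyi : IntegrableOn (fun t => y t ^ 2) (Set.Ioi 0))
    (hlim : Tendsto z atTop (nhds 0)) :
    (∫ t in Set.Ioi (0 : ℝ), y t ^ 2) ≥
      (α / (k + α * ky)) ^ 2 * ∫ t in Set.Ioi (0 : ℝ), (Real.exp (-(k / α) * t)) ^ 2 := by
  set a : ℝ := k / α with ha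
  have ha0 : 0 < a := div_pos hk hα
  set l : ℝ := α / (k + α * ky) with hl
  have hD : 0 < k + α * ky := by positivity
  set c : ℝ := (k + α * ky) / α ^ 2 with hc
  have hlc : c * l = 1 / α := by
    rw [hl, hc]; field_simp
  have hc0 : 0 < c := by positivity
  have hE : IntegrableOn (fun t : ℝ => Real.exp (-a * t)) (Set.Ioi 0) :=
    exp_neg_integrableOn_Ioi 0 ha0
  have hE2 : IntegrableOn (fun t : ℝ => Real.exp (-a * t) ^ 2) (Set.Ioi 0) := by
    have h := exp_neg_integrableOn_Ioi 0 (b := 2 * a) (by positivity)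
    refine h.congr_fun (fun t _ => ?_) measurableSet_Ioi
    simp only
    rw [← Real.exp_nat_mul]
    congr 1
    push_cast
    ring
  have hEy : IntegrableOn (fun t : ℝ => Real.exp (-a * t) * y t) (Set.Ioi 0) := by
    refine Integrable.mono' (hE2.add hyi) ?_ ?_
    · exact Measurable.aestronglyMeasurable (by fun_prop)
    · refine Eventually.of_forall (fun t => ?_)
      simp only [Pi.add_apply, Real.norm_eq_abs]
      rw [abs_le]
      constructor <;> nlinarith [sq_nonneg (Real.exp (-a * t) + y t),
        sq_nonneg (Real.exp (-a * t) - y t), sq_nonneg (Real.exp (-a * t)), sq_nonneg (y t)]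
  have hexp : Tendsto (fun t : ℝ => Real.exp (-a * t)) atTop (nhds 0) :=
    Real.tendsto_exp_atBot.comp (tendsto_id.const_mul_atTop_of_neg (by linarith))
  have hw : Tendsto (fun t => Real.exp (-a * t) * z t) atTop (nhds 0) := by
    simpa using hexp.mul hlim
  have hI1 : IntegrableOn (fun t : ℝ => (-c) * (Real.exp (-a * t) * y t)) (Set.Ioi 0) :=
    hEy.const_mul _
  have hI2 : IntegrableOn (fun t : ℝ => (1 / α) * Real.exp (-a * t) ^ 2) (Set.Ioi 0) :=
    hE2.const_mul _
  have key := integral_Ioi_of_hasDerivAt_of_tendsto' (a := 0)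
    (f := fun t => Real.exp (-a * t) * z t)
    (f' := fun t => (-c) * (Real.exp (-a * t) * y t) - (1 / α) * Real.exp (-a * t) ^ 2)
    (fun t ht => by
      have h1 : HasDerivAt (fun t : ℝ => Real.exp (-a * t)) (Real.exp (-a * t) * (-a * 1)) t :=
        ((hasDerivAt_id t).const_mul (-a)).exp
      exact (h1.mul (hz t ht)).congr_deriv (by ring))
    (hI1.sub hI2) hw
  rw [integral_sub hI1 hI2, integral_const_mul, integral_const_mul, hz0, ← hlc] at key
  have hA : (∫ t in Set.Ioi (0 : ℝ), Real.exp (-a * t) * y t)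
      = -l * ∫ t in Set.Ioi (0 : ℝ), Real.exp (-a * t) ^ 2 := by
    apply mul_left_cancel₀ hc0.ne'
    linarith
  have hJ1 : IntegrableOn (fun t : ℝ => (-2 * l) * (Real.exp (-a * t) * y t)) (Set.Ioi 0) :=
    hEy.const_mul _
  have hJ2 : IntegrableOn (fun t : ℝ => l ^ 2 * Real.exp (-a * t) ^ 2) (Set.Ioi 0) :=
    hE2.const_mul _
  have hm : (∫ t in Set.Ioi (0 : ℝ), ((-2 * l) * (Real.exp (-a * t) * y t)
      - l ^ 2 * Real.exp (-a * t) ^ 2)) ≤ ∫ t in Set.Ioi (0 : ℝ), y t ^ 2 := by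
    refine integral_mono (hJ1.sub hJ2) hyi (fun t => ?_)
    simp only
    nlinarith [sq_nonneg (y t + l * Real.exp (-a * t))]
  rw [integral_sub hJ1 hJ2, integral_const_mul, integral_const_mul, hA] at hm
  linarith
end
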